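/- Let δ > 0 and 0 < ε < 1, set b = ln(1/ε), and let φ'(t) = (b/(δ sinh b)) · I₀(b·√(1 − (2t/δ − 1)²)) for 0 ≤ t ≤ δ and φ'(t) = 0 otherwise, where I₀(x) = (1/π)∫₀^π e^{x cos θ} dθ. Let φ̂'(ω) = ∫₀^δ φ'(t) e^{iωt} dt. Then for every θ > 1 and every real ω with |ω| ≥ 2b/(δ·√(1 − 1/θ²)), one has |φ̂'(ω)| ≤ (4bθ/(δ(1 − ε²))) · ε/|ω|. -/

import Mathlib

open Real MeasureTheory

/-- Modified Bessel function of the first kind of order zero,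
`I₀(x) = (1/π) ∫₀^π e^{x cos θ} dθ`. -/
noncomputable def besselI0 (x : ℝ) : ℝ :=
  (1 / π) * ∫ θ in (0:ℝ)..π, Real.exp (x * Real.cos θ)

/-- The Kaiser–Bessel window derivative `φ'` with shape parameter `b` on `[0, δ]`. -/
noncomputable def kbDeriv (b δ t : ℝ) : ℝ :=
  if 0 ≤ t ∧ t ≤ δ then
    (b / (δ * Real.sinh b)) * besselI0 (b * Real.sqrt (1 - (2 * t / δ - 1) ^ 2))
  else 0


lemma kb_W_even (k : ℕ) : ∫ x in (0:ℝ)..π, Real.cos x ^ (2*k) = π * ((2*k).factorial / (4^k * (k.factorial:ℝ)^2)) := by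
  induction k with
  | zero => simp
  | succ k ih =>
    rw [show 2*(k+1) = 2*k+2 by ring, integral_cos_pow, ih]
    simp only [Nat.factorial_succ, Real.sin_pi, Real.sin_zero]
    push_cast
    have : (k.factorial:ℝ) ≠ 0 := by positivity
    field_simp
    ring

lemma kb_W_odd (k : ℕ) : ∫ x in (0:ℝ)..π, Real.cos x ^ (2*k+1) = 0 := by
  induction k with
  | zero => simp
  | succ k ih =>
    rw [show 2*(k+1)+1 = (2*k+1)+2 by ring, integral_cos_pow, ih]
    simp

lemma kb_J (k : ℕ) : ∀ m : ℕ, ∫ x in (-1:ℝ)..1, x^(2*m) * (1-x^2)^k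
    = 2 * 4^k * (k.factorial:ℝ) * ((2*m).factorial:ℝ) * ((m+k).factorial:ℝ) / ((m.factorial:ℝ) * ((2*m+2*k+1).factorial:ℝ)) := by
  induction k with
  | zero =>
    intro m
    simp only [pow_zero, mul_one, integral_pow, Nat.factorial_succ, mul_zero, add_zero]
    have : (m.factorial:ℝ) ≠ 0 := by positivity
    have : ((2*m).factorial:ℝ) ≠ 0 := by positivity
    push_cast
    rw [(show Odd (2*m+1) from ⟨m, rfl⟩).neg_pow]
    simp
    field_simp
    norm_num
  | succ k ih =>
    intro m
    have key : ∫ x in (-1:ℝ)..1, ((1-x^2)^(k+1)) * x^(2*m) = 2*((k:ℝ)+1)/(2*(m:ℝ)+1) * ∫ x in (-1:ℝ)..1, x^(2*(m+1)) * (1-x^2)^k := by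
      rw [intervalIntegral.integral_mul_deriv_eq_deriv_mul (u := fun x => (1-x^2)^(k+1)) (u' := fun x => ((k+1:ℕ):ℝ) * (1-x^2)^k * (-(2*x))) (v := fun x => x^(2*m+1)/(2*m+1)) (v' := fun x => x^(2*m))]
      · rw [← intervalIntegral.integral_const_mul]
        simp only [one_pow, sub_self, even_two.neg_one_pow]
        rw [zero_pow (by omega), zero_mul, zero_mul, sub_zero, zero_sub, ← intervalIntegral.integral_neg]
        congr 1; ext x
        push_cast
        field_simp
        ring
      · intro x _
        have := ((hasDerivAt_pow 2 x).const_sub 1).pow (k+1)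
        simpa using! this
      · intro x _
        have := (hasDerivAt_pow (2*m+1) x).div_const (2*(m:ℝ)+1)
        convert this using 1
        push_cast
        field_simp
      · exact (by fun_prop : Continuous _).intervalIntegrable _ _
      · exact (by fun_prop : Continuous _).intervalIntegrable _ _
    simp_rw [mul_comm (_^(2*m))]
    rw [key, ih, show 2*(m+1) = 2*m+1+1 by ring, show m+1+k = m+k+1 by ring, show 2*m+1+1+2*k+1 = 2*m+2*k+1+1+1 by ring, show m+(k+1) = m+k+1 by ring, show 2*m+2*(k+1)+1 = 2*m+2*k+1+1+1 by ring]
    simp only [Nat.factorial_succ]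
    have : (m.factorial:ℝ) ≠ 0 := by positivity
    have : ((2*m).factorial:ℝ) ≠ 0 := by positivity
    have : ((2*m+2*k).factorial:ℝ) ≠ 0 := by positivity
    push_cast
    field_simp
    ring

lemma kb_J_odd (k m : ℕ) : ∫ x in (-1:ℝ)..1, x^(2*m+1) * (1-x^2)^k = 0 := by
  have h := intervalIntegral.integral_comp_neg (a := -1) (b := 1) (fun x : ℝ => x^(2*m+1) * (1-x^2)^k)
  simp only [neg_neg, even_two.neg_pow, (show Odd (2*m+1) from ⟨m, rfl⟩).neg_pow, neg_mul, intervalIntegral.integral_neg] at h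
  linarith

lemma kb_sum_even (f : ℕ → ℂ) (hf : ∀ k, f (2*k+1) = 0) (n : ℕ) :
    ∑ j ∈ Finset.range (2*n+1), f j = ∑ k ∈ Finset.range (n+1), f (2*k) := by
  induction n with
  | zero => simp
  | succ n ih =>
    rw [show 2*(n+1)+1 = 2*n+1+1+1 by ring, Finset.sum_range_succ, Finset.sum_range_succ, ih, hf, Finset.sum_range_succ _ (n+1)]
    simp; rfl

noncomputable def kbW (j : ℕ) : ℝ := ∫ x in (0:ℝ)..π, Real.cos x ^ j
noncomputable def kbK (p j : ℕ) : ℝ := ∫ x in (-1:ℝ)..1, x^p * Real.sqrt (1-x^2) ^ j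

lemma kbK_even (p k : ℕ) : kbK p (2*k) = ∫ x in (-1:ℝ)..1, x^p * (1-x^2)^k := by
  unfold kbK
  apply intervalIntegral.integral_congr
  intro x hx
  rw [Set.uIcc_of_le (by norm_num)] at hx
  simp only
  rw [pow_mul, Real.sq_sqrt (by nlinarith [hx.1, hx.2])]

noncomputable def kbM (a b : ℝ) (n : ℕ) : ℂ :=
  ∫ x in (-1:ℝ)..1, ∫ y in (0:ℝ)..π,
    (((b * Real.sqrt (1-x^2) * Real.cos y : ℝ) : ℂ) + Complex.I * ((a * x : ℝ) : ℂ)) ^ n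

lemma kbM_eq (a b : ℝ) (n : ℕ) : kbM a b n = ∑ j ∈ Finset.range (n+1),
    (b:ℂ)^j * (Complex.I * a)^(n-j) * (n.choose j : ℂ) * (kbW j : ℂ) * (kbK (n-j) j : ℂ) := by
  have h1 : ∀ x : ℝ, ∫ y in (0:ℝ)..π,
    (((b * Real.sqrt (1-x^2) * Real.cos y : ℝ) : ℂ) + Complex.I * ((a * x : ℝ) : ℂ)) ^ n
     = ∑ j ∈ Finset.range (n+1), ((b:ℂ)^j * (Complex.I * a)^(n-j) * (n.choose j : ℂ) * (kbW j : ℂ)) * ((x^(n-j) * Real.sqrt (1-x^2) ^ j : ℝ) : ℂ) := by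
    intro x
    simp_rw [add_pow]
    rw [intervalIntegral.integral_finsetSum]
    · apply Finset.sum_congr rfl
      intro j _
      rw [kbW, ← intervalIntegral.integral_ofReal, ← intervalIntegral.integral_const_mul, ← intervalIntegral.integral_mul_const]
      congr 1; ext y
      push_cast
      ring
    · intro j _
      exact (by fun_prop : Continuous _).intervalIntegrable _ _
  unfold kbM
  simp_rw [h1]
  rw [intervalIntegral.integral_finsetSum]
  · apply Finset.sum_congr rfl
    intro j _
    rw [kbK, ← intervalIntegral.integral_ofReal, ← intervalIntegral.integral_const_mul]
  · intro j _
    exact (by fun_prop : Continuous _).intervalIntegrable _ _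

lemma kbM_odd (a b : ℝ) (n : ℕ) : kbM a b (2*n+1) = 0 := by
  rw [kbM_eq]
  apply Finset.sum_eq_zero
  intro j hj
  rw [Finset.mem_range] at hj
  rcases Nat.even_or_odd' j with ⟨k, rfl | rfl⟩
  · rw [kbK_even, show 2*n+1-2*k = 2*(n-k)+1 by omega, kb_J_odd]
    simp
  · rw [kbW, kb_W_odd]
    simp

lemma kbM_even (a b : ℝ) (n : ℕ) : kbM a b (2*n) = ((2 * π * (b^2-a^2)^n / (2*n+1) : ℝ) : ℂ) := by
  rw [kbM_eq, kb_sum_even]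
  · have : (b^2-a^2)^n = (b^2+ -a^2)^n := by ring
    rw [this, add_pow]
    rw [Finset.mul_sum, Finset.sum_div]
    push_cast
    apply Finset.sum_congr rfl
    intro k hk
    rw [Finset.mem_range] at hk
    obtain ⟨m, rfl⟩ : ∃ m, n = m + k := ⟨n-k, by omega⟩
    rw [kbK_even, show 2*(m+k)-2*k = 2*m by omega, show m+k-k = m by omega, kb_J, kbW, kb_W_even]
    rw [pow_mul (Complex.I * _), mul_pow Complex.I, Complex.I_sq, Nat.cast_choose ℂ (by omega : 2*k ≤ 2*(m+k)), Nat.cast_choose ℂ (by omega : k ≤ m+k), show 2*(m+k)-2*k = 2*m by omega, show m+k-k = m by omega, show 2*m+2*k+1 = 2*(m+k)+1 by ring, Nat.factorial_succ (2*(m+k))]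
    have h1 : (m.factorial:ℂ) ≠ 0 := by exact_mod_cast Nat.factorial_ne_zero _
    have h2 : (k.factorial:ℂ) ≠ 0 := by exact_mod_cast Nat.factorial_ne_zero _
    have h3 : ((2*m).factorial:ℂ) ≠ 0 := by exact_mod_cast Nat.factorial_ne_zero _
    have h4 : ((2*k).factorial:ℂ) ≠ 0 := by exact_mod_cast Nat.factorial_ne_zero _
    have h5 : ((2*(m+k)).factorial:ℂ) ≠ 0 := by exact_mod_cast Nat.factorial_ne_zero _
    have h6 : (2*((m:ℂ)+k)+1) ≠ 0 := by exact_mod_cast Nat.succ_ne_zero (2*(m+k))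
    push_cast
    field_simp
    ring
  · intro k
    rw [kbW, kb_W_odd]
    simp

lemma kb_hasSum (a b : ℝ) : HasSum (fun n : ℕ => kbM a b n / (n.factorial : ℂ))
    (∫ x in (-1:ℝ)..1, ∫ y in (0:ℝ)..π,
    Complex.exp (((b * Real.sqrt (1-x^2) * Real.cos y : ℝ) : ℂ) + Complex.I * ((a * x : ℝ) : ℂ))) := by
  have hz : ∀ x y : ℝ, x ∈ Set.uIoc (-1:ℝ) 1 → ‖(((b * Real.sqrt (1-x^2) * Real.cos y : ℝ) : ℂ) + Complex.I * ((a * x : ℝ) : ℂ))‖ ≤ |b| + |a| := by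
    intro x y hx
    rw [Set.uIoc_of_le (by norm_num)] at hx
    refine (norm_add_le _ _).trans (add_le_add ?_ ?_)
    · rw [Complex.norm_real, norm_mul, norm_mul, Real.norm_eq_abs, Real.norm_eq_abs, Real.norm_eq_abs, abs_of_nonneg (Real.sqrt_nonneg _)]
      have h1 : Real.sqrt (1-x^2) ≤ 1 := Real.sqrt_le_one.mpr (by nlinarith)
      have h2 := Real.abs_cos_le_one y
      calc |b| * √(1-x^2) * |Real.cos y| ≤ |b| * 1 * 1 := by gcongr
        _ = |b| := by ring
    · rw [norm_mul, Complex.norm_I, Complex.norm_real, Real.norm_eq_abs, abs_mul, one_mul]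
      have : |x| ≤ 1 := abs_le.mpr ⟨hx.1.le, hx.2⟩
      nlinarith [abs_nonneg a]
  set C := |b| + |a| with hC
  have hC0 : 0 ≤ C := by positivity
  have hs : Summable (fun n : ℕ => C^n / (n.factorial:ℝ)) := Real.summable_pow_div_factorial C
  have hinner : ∀ x : ℝ, x ∈ Set.uIoc (-1:ℝ) 1 → HasSum (fun n : ℕ => ∫ y in (0:ℝ)..π,
      (((b * Real.sqrt (1-x^2) * Real.cos y : ℝ) : ℂ) + Complex.I * ((a * x : ℝ) : ℂ)) ^ n / (n.factorial : ℂ))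
      (∫ y in (0:ℝ)..π, Complex.exp (((b * Real.sqrt (1-x^2) * Real.cos y : ℝ) : ℂ) + Complex.I * ((a * x : ℝ) : ℂ))) := by
    intro x hx
    apply intervalIntegral.hasSum_integral_of_dominated_convergence (fun n _ => C^n / (n.factorial:ℝ))
    · intro n
      exact (by fun_prop : Continuous _).aestronglyMeasurable
    · intro n
      refine Filter.Eventually.of_forall fun y _ => ?_
      rw [norm_div, norm_pow, Complex.norm_natCast]
      gcongr
      exact hz x y hx
    · exact Filter.Eventually.of_forall fun y _ => hs
    · exact intervalIntegrable_const
    · refine Filter.Eventually.of_forall fun y _ => ?_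
      rw [Complex.exp_eq_exp_ℂ]
      exact NormedSpace.expSeries_div_hasSum_exp _
  have := intervalIntegral.hasSum_integral_of_dominated_convergence (μ := volume) (a := -1) (b := 1)
    (F := fun (n : ℕ) (x : ℝ) => ∫ y in (0:ℝ)..π,
      (((b * Real.sqrt (1-x^2) * Real.cos y : ℝ) : ℂ) + Complex.I * ((a * x : ℝ) : ℂ)) ^ n / (n.factorial : ℂ))
    (f := fun x => ∫ y in (0:ℝ)..π, Complex.exp (((b * Real.sqrt (1-x^2) * Real.cos y : ℝ) : ℂ) + Complex.I * ((a * x : ℝ) : ℂ)))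
    (fun n _ => C^n / (n.factorial:ℝ) * |π - 0|) ?_ ?_ ?_ ?_ ?_
  · simp_rw [intervalIntegral.integral_div] at this
    exact this
  · intro n
    apply Continuous.aestronglyMeasurable
    apply intervalIntegral.continuous_parametric_intervalIntegral_of_continuous'
    fun_prop
  · intro n
    refine Filter.Eventually.of_forall fun x hx => ?_
    apply intervalIntegral.norm_integral_le_of_norm_le_const
    intro y _
    rw [norm_div, norm_pow, Complex.norm_natCast]
    gcongr
    exact hz x y hx
  · exact Filter.Eventually.of_forall fun y _ => hs.mul_right _
  · exact intervalIntegrable_const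
  · exact Filter.Eventually.of_forall hinner

lemma kb_key (a b s : ℝ) (hs : 0 < s) (hab : a^2 - b^2 = s^2) :
    (∫ x in (-1:ℝ)..1, ∫ y in (0:ℝ)..π,
    Complex.exp (((b * Real.sqrt (1-x^2) * Real.cos y : ℝ) : ℂ) + Complex.I * ((a * x : ℝ) : ℂ)))
    = ((2 * π * Real.sin s / s : ℝ) : ℂ) := by
  have h := kb_hasSum a b
  have hinj : Function.Injective (fun n : ℕ => 2*n) := fun _ _ h => by simpa using h
  rw [← hinj.hasSum_iff] at h
  · refine h.unique ?_
    have h2 := (Complex.hasSum_ofReal.mpr ((Real.hasSum_sin s).mul_left (2*π/s)))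
    convert h2 using 1
    · ext n
      simp only [Function.comp]
      rw [kbM_even, Nat.factorial_succ, show b^2-a^2 = -1 * s^2 by linarith, mul_pow, ← pow_mul]
      have h5 : ((2*n).factorial:ℂ) ≠ 0 := by exact_mod_cast Nat.factorial_ne_zero _
      have h6 : (2*(n:ℂ)+1) ≠ 0 := by exact_mod_cast Nat.succ_ne_zero (2*n)
      have h7 : (s:ℂ) ≠ 0 := by exact_mod_cast hs.ne'
      push_cast
      field_simp
      ring
    · congr 1; ring
  · intro n hn
    rcases Nat.even_or_odd' n with ⟨k, rfl | rfl⟩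
    · exact absurd ⟨k, rfl⟩ hn
    · rw [kbM_odd]; simp

/-- Tail decay of the Fourier transform of the Kaiser–Bessel window beyond its
ε-bandlimit: with `b = ln(1/ε)`, for every `θ > 1` and `|ω| ≥ 2b/(δ√(1 − 1/θ²))`,
`|φ̂'(ω)| ≤ (4bθ/(δ(1 − ε²))) · ε/|ω|`. -/
theorem stmt1 (δ ε : ℝ) (hδ : 0 < δ) (hε0 : 0 < ε) (hε1 : ε < 1)
    (θ ω : ℝ) (hθ : 1 < θ)
    (hω : |ω| ≥ 2 * Real.log (1 / ε) / (δ * Real.sqrt (1 - 1 / θ ^ 2))) :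
    ‖(∫ t in (0:ℝ)..δ,
        (kbDeriv (Real.log (1 / ε)) δ t : ℂ) * Complex.exp (Complex.I * ω * t))‖ ≤
      4 * Real.log (1 / ε) * θ / (δ * (1 - ε ^ 2)) * ε / |ω| := by
  set b := Real.log (1 / ε) with hb
  have hb0 : 0 < b := Real.log_pos (by rw [lt_div_iff₀ hε0]; linarith)
  have hsinh : Real.sinh b = (1 - ε^2) / (2*ε) := by
    rw [Real.sinh_eq, Real.exp_neg, hb, Real.exp_log (by positivity)]
    field_simp
  have h1ε : 0 < 1 - ε^2 := by nlinarith
  have hsp : 0 < Real.sinh b := by rw [hsinh]; positivity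
  have hθ2 : 0 < 1 - 1/θ^2 := by
    rw [sub_pos, div_lt_one (by positivity)]; nlinarith
  set q := Real.sqrt (1 - 1/θ^2) with hq
  have hq0 : 0 < q := Real.sqrt_pos.mpr hθ2
  have hq2 : q^2 = 1 - 1/θ^2 := Real.sq_sqrt hθ2.le
  have hθ0 : 0 < θ := by linarith
  have hω0 : 0 < |ω| := lt_of_lt_of_le (by positivity) hω
  set a := ω * δ / 2 with ha
  have haabs : |a| = |ω| * δ / 2 := by
    rw [ha, abs_div, abs_mul, abs_of_pos hδ, abs_of_pos (two_pos : (0:ℝ) < 2)]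
  have ha0 : 0 < |a| := by rw [haabs]; positivity
  have hbq : b ≤ |a| * q := by
    rw [ge_iff_le, div_le_iff₀ (by positivity)] at hω
    rw [haabs]; linarith
  have hb2 : b^2 ≤ a^2 * (1 - 1/θ^2) := by
    rw [← hq2, ← sq_abs a, ← mul_pow]
    gcongr
  have hge : (|a|/θ)^2 ≤ a^2 - b^2 := by
    rw [div_pow, sq_abs]
    have : a^2 * (1 - 1/θ^2) = a^2 - a^2/θ^2 := by ring
    linarith
  set s := Real.sqrt (a^2-b^2) with hs
  have hsge : |a|/θ ≤ s := Real.le_sqrt_of_sq_le hge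
  have hs0 : 0 < s := lt_of_lt_of_le (by positivity) hsge
  have hs2 : a^2-b^2 = s^2 := (Real.sq_sqrt (le_trans (by positivity) hge)).symm
  have key := kb_key a b s hs0 hs2
  set g : ℝ → ℂ := fun x => ∫ y in (0:ℝ)..π,
    Complex.exp (((b * Real.sqrt (1-x^2) * Real.cos y : ℝ) : ℂ) + Complex.I * ((a * x : ℝ) : ℂ)) with hg
  have hI : (∫ t in (0:ℝ)..δ, (kbDeriv b δ t : ℂ) * Complex.exp (Complex.I * ω * t))
      = ((b / (δ * Real.sinh b) / π : ℝ) : ℂ) * Complex.exp (((a : ℝ):ℂ) * Complex.I) * ((δ/2 : ℝ) : ℂ) * ∫ x in (-1:ℝ)..1, g x := by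
    have h1 : (∫ t in (0:ℝ)..δ, (kbDeriv b δ t : ℂ) * Complex.exp (Complex.I * ω * t))
      = ∫ t in (0:ℝ)..δ, ((b / (δ * Real.sinh b) / π : ℝ) : ℂ) * Complex.exp (((a : ℝ):ℂ) * Complex.I) * g (2/δ * t - 1) := by
      apply intervalIntegral.integral_congr
      intro t ht
      rw [Set.uIcc_of_le hδ.le] at ht
      simp only [hg]
      rw [kbDeriv, if_pos ⟨ht.1, ht.2⟩, besselI0]
      simp_rw [Complex.exp_add]
      rw [intervalIntegral.integral_mul_const]
      simp_rw [← Complex.ofReal_exp]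
      rw [intervalIntegral.integral_ofReal]
      have he : Complex.exp (Complex.I * ω * t) = Complex.exp (((a : ℝ):ℂ) * Complex.I) * Complex.exp (Complex.I * ((a * (2/δ*t-1) : ℝ) : ℂ)) := by
        rw [← Complex.exp_add]
        congr 1
        have : ((a * (2/δ*t-1) : ℝ) : ℂ) = ((ω * t - a : ℝ) : ℂ) := by
          congr 1; rw [ha]; field_simp
        rw [this]; push_cast; ring
      rw [he, show 2 * t / δ = 2/δ*t by ring]
      push_cast
      ring
    rw [h1, intervalIntegral.integral_const_mul, intervalIntegral.integral_comp_mul_sub (hc := by positivity)]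
    rw [show 2/δ*0 - 1 = -1 by ring, show 2/δ*δ - 1 = 1 by field_simp; norm_num, Complex.real_smul]
    push_cast
    rw [inv_div]
    ring
  rw [hI, key, norm_mul, norm_mul, norm_mul, Complex.norm_exp_ofReal_mul_I, Complex.norm_real, Complex.norm_real, Complex.norm_real]
  have hpi := Real.pi_pos
  simp only [Real.norm_eq_abs]
  rw [abs_of_pos (by positivity : 0 < b / (δ * Real.sinh b) / π), abs_of_pos (by positivity : 0 < δ/2), abs_div, abs_mul, abs_of_pos (by positivity : 0 < 2 * π), abs_of_pos hs0]
  calc b / (δ * Real.sinh b) / π * 1 * (δ/2) * (2 * π * |Real.sin s| / s)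
      ≤ b / (δ * Real.sinh b) / π * 1 * (δ/2) * (2 * π * 1 / (|a|/θ)) := by
        gcongr
        exact Real.abs_sin_le_one s
    _ = _ := by
        rw [hsinh, haabs]
        field_simp
        try ring
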